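/- Under assumptions (A1)–(A4), let c be the unique fixed point of f₀∘f₁ in [1−x₀, y₀]. For every ρ > 0 and every x ∈ (0,1), ℙ_x({ω ∈ Σ : there exists n ≥ 1 with f^n_ω(x) ∈ (c−ρ, c+ρ)}) = 1; that is, the first hitting time of (c−ρ, c+ρ) by the random orbit started at x is finite ℙ_x-almost surely. -/

import Mathlib

/-
Formalization of the Alsedà–Misiurewicz system setup:
`f0, f1` are the piecewise-linear interval homeomorphisms, `iter` the random
iteration along ω ∈ Σ = {0,1}^ℕ, `IsKernel` characterises the family x ↦ ℙ_x by
its values on cylinder sets, `Pop` is the Markov operator (as a set function),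
`Stationary` expresses P-invariance for probability measures on (0,1), `U` is
the dual operator, and `A1`–`A4` are the assumptions of the paper.
-/

open MeasureTheory Filter Set
open scoped ENNReal Topology

namespace AM

noncomputable def f0 (x₀ y₀ : ℝ) (x : ℝ) : ℝ :=
  if x ≤ x₀ then (y₀ / x₀) * x else ((1 - y₀) / (1 - x₀)) * (x - 1) + 1

noncomputable def f1 (x₀ y₀ : ℝ) (x : ℝ) : ℝ := 1 - f0 x₀ y₀ (1 - x)

/-- `fb b` is `f₁` if `b = true`, and `f₀` if `b = false`. -/
noncomputable def fb (x₀ y₀ : ℝ) (b : Bool) : ℝ → ℝ :=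
  if b then f1 x₀ y₀ else f0 x₀ y₀

/-- `iter x₀ y₀ ω n x = f^n_ω(x) = f_{ω (n-1)} ∘ ⋯ ∘ f_{ω 0} (x)`, with `f^0_ω = id`. -/
noncomputable def iter (x₀ y₀ : ℝ) (ω : ℕ → Bool) : ℕ → ℝ → ℝ
  | 0, x => x
  | n + 1, x => fb x₀ y₀ (ω n) (iter x₀ y₀ ω n x)

/-- `cylProb x₀ y₀ p₀ p₁ x w = p_{i₁}(x) p_{i₂}(f_{i₁} x) ⋯` for the word `w = (i₁, …, i_k)`. -/
noncomputable def cylProb (x₀ y₀ : ℝ) (p₀ p₁ : ℝ → ℝ) : ℝ → List Bool → ℝ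
  | _, [] => 1
  | x, b :: w => (if b then p₁ x else p₀ x) * cylProb x₀ y₀ p₀ p₁ (fb x₀ y₀ b x) w

/-- The cylinder set of sequences starting with the word `w`. -/
def cyl (w : List Bool) : Set (ℕ → Bool) := {ω | ∀ j : Fin w.length, ω j = w.get j}

/-- `IsKernel x₀ y₀ p₀ p₁ Pm` says that `Pm x = ℙ_x` for all `x ∈ (0,1)`, i.e. `Pm x` gives
every cylinder set its prescribed probability (this determines `Pm x` uniquely and makes it a
probability measure, since the empty word gives `Pm x univ = 1`). -/
def IsKernel (x₀ y₀ : ℝ) (p₀ p₁ : ℝ → ℝ) (Pm : ℝ → Measure (ℕ → Bool)) : Prop :=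
  ∀ x ∈ Ioo (0:ℝ) 1, ∀ w : List Bool,
    Pm x (cyl w) = ENNReal.ofReal (cylProb x₀ y₀ p₀ p₁ x w)

/-- The Markov operator `P`, as a set function:
`Pop μ A = ∫_{f₀⁻¹(A)} p₀ dμ + ∫_{f₁⁻¹(A)} p₁ dμ`. -/
noncomputable def Pop (x₀ y₀ : ℝ) (p₀ p₁ : ℝ → ℝ) (μ : Measure ℝ) (A : Set ℝ) : ℝ≥0∞ :=
  (∫⁻ x in f0 x₀ y₀ ⁻¹' A, ENNReal.ofReal (p₀ x) ∂μ) +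
    ∫⁻ x in f1 x₀ y₀ ⁻¹' A, ENNReal.ofReal (p₁ x) ∂μ

/-- A stationary (P-invariant) Borel probability measure on (0,1). -/
def Stationary (x₀ y₀ : ℝ) (p₀ p₁ : ℝ → ℝ) (μ : Measure ℝ) : Prop :=
  IsProbabilityMeasure μ ∧ μ (Ioo 0 1) = 1 ∧
    ∀ A : Set ℝ, MeasurableSet A → A ⊆ Ioo 0 1 → μ A = Pop x₀ y₀ p₀ p₁ μ A

/-- The dual operator `Uφ(x) = p₀(x) φ(f₀ x) + p₁(x) φ(f₁ x)`. -/
noncomputable def U (x₀ y₀ : ℝ) (p₀ p₁ : ℝ → ℝ) (φ : ℝ → ℝ) : ℝ → ℝ :=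
  fun x => p₀ x * φ (f0 x₀ y₀ x) + p₁ x * φ (f1 x₀ y₀ x)

/-- Assumption (A1): `1/2 < x₀ < 1` and `1/2 ≤ y₀ < x₀`. -/
def A1 (x₀ y₀ : ℝ) : Prop := 1/2 < x₀ ∧ x₀ < 1 ∧ 1/2 ≤ y₀ ∧ y₀ < x₀

/-- Assumption (A2): Dini continuity of `p₀, p₁`; `β` is a modulus of continuity for both, with
`∑ₙ β(C tⁿ) < ∞` for all `C ≥ 0`, `0 < t < 1`. (Such a `β` exists iff the least modulus of
continuity has this summability property.) -/
def A2 (p₀ p₁ : ℝ → ℝ) : Prop :=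
  ∃ β : ℝ → ℝ,
    (∀ t : ℝ, ∀ x ∈ Icc (0:ℝ) 1, ∀ y ∈ Icc (0:ℝ) 1, |x - y| ≤ t →
      |p₀ x - p₀ y| ≤ β t ∧ |p₁ x - p₁ y| ≤ β t) ∧
    (∀ C : ℝ, 0 ≤ C → ∀ t : ℝ, 0 < t → t < 1 → Summable fun n : ℕ => β (C * t ^ n))

/-- Assumption (A3): `p₀, p₁` are continuous, `p₀ + p₁ = 1`, and `0 < pᵢ < 1` on `[0,1]`. -/
def A3 (p₀ p₁ : ℝ → ℝ) : Prop :=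
  ContinuousOn p₀ (Icc 0 1) ∧ ContinuousOn p₁ (Icc 0 1) ∧
    ∀ x ∈ Icc (0:ℝ) 1, p₀ x + p₁ x = 1 ∧ 0 < p₀ x ∧ p₀ x < 1 ∧ 0 < p₁ x ∧ p₁ x < 1

/-- Assumption (A4): the average Lyapunov exponents at 0 and 1 are positive
(`a₀ = y₀/x₀`, `a₁ = (1-y₀)/(1-x₀)`). -/
def A4 (x₀ y₀ : ℝ) (p₀ p₁ : ℝ → ℝ) : Prop :=
  0 < p₀ 0 * Real.log (y₀ / x₀) + p₁ 0 * Real.log ((1 - y₀) / (1 - x₀)) ∧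
    0 < p₀ 1 * Real.log ((1 - y₀) / (1 - x₀)) + p₁ 1 * Real.log (y₀ / x₀)

end AM

namespace AM

variable {x₀ y₀ : ℝ} {p₀ p₁ : ℝ → ℝ}

theorem f0_of_le {x : ℝ} (h : x ≤ x₀) : f0 x₀ y₀ x = y₀ / x₀ * x := if_pos h

theorem f0_of_lt {x : ℝ} (h : x₀ < x) :
    f0 x₀ y₀ x = (1 - y₀) / (1 - x₀) * (x - 1) + 1 := if_neg h.not_ge

theorem A1.slopes (h : A1 x₀ y₀) :
    0 < y₀ / x₀ ∧ y₀ / x₀ < 1 ∧ 1 < (1 - y₀) / (1 - x₀) := by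
  obtain ⟨h1, h2, h3, h4⟩ := h
  refine ⟨by apply div_pos <;> linarith, ?_, ?_⟩
  · rw [div_lt_one (by linarith)]; exact h4
  · rw [one_lt_div (by linarith)]; linarith

theorem continuous_f0 (h : A1 x₀ y₀) : Continuous (f0 x₀ y₀) := by
  obtain ⟨h1, h2, h3, h4⟩ := h
  have : x₀ ≠ 0 := by linarith
  have : 1 - x₀ ≠ 0 := by linarith
  refine Continuous.if_le (by fun_prop) (by fun_prop) continuous_id continuous_const ?_
  rintro x rfl
  field_simp
  ring

theorem continuous_f1 (h : A1 x₀ y₀) : Continuous (f1 x₀ y₀) := by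
  have := continuous_f0 h
  unfold f1
  fun_prop

theorem f0_mem_Ioo (h : A1 x₀ y₀) {x : ℝ} (hx : x ∈ Ioo (0 : ℝ) 1) :
    f0 x₀ y₀ x ∈ Ioo (0 : ℝ) 1 := by
  obtain ⟨s1, s2, s3⟩ := h.slopes
  obtain ⟨h1, h2, h3, h4⟩ := h
  rcases le_or_gt x x₀ with hle | hlt
  · rw [f0_of_le hle]
    exact ⟨mul_pos s1 hx.1, by nlinarith [hx.1, hx.2]⟩
  · rw [f0_of_lt hlt]
    have e : (1 - y₀) / (1 - x₀) * (1 - x₀) = 1 - y₀ := div_mul_cancel₀ _ (by linarith)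
    constructor <;> nlinarith [hx.1, hx.2]

theorem f0_mem_Icc (h : A1 x₀ y₀) {x : ℝ} (hx : x ∈ Icc (0 : ℝ) 1) :
    f0 x₀ y₀ x ∈ Icc (0 : ℝ) 1 := by
  have hc : closure (Ioo (0 : ℝ) 1) = Icc 0 1 := closure_Ioo (by norm_num)
  rw [← hc] at hx ⊢
  exact map_mem_closure (continuous_f0 h) hx fun y hy => f0_mem_Ioo h hy

theorem f1_mem_Ioo (h : A1 x₀ y₀) {x : ℝ} (hx : x ∈ Ioo (0 : ℝ) 1) :
    f1 x₀ y₀ x ∈ Ioo (0 : ℝ) 1 := by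
  have := f0_mem_Ioo h (x := 1 - x) ⟨by linarith [hx.2], by linarith [hx.1]⟩
  exact ⟨by unfold f1; linarith [this.2], by unfold f1; linarith [this.1]⟩

theorem f1_mem_Icc (h : A1 x₀ y₀) {x : ℝ} (hx : x ∈ Icc (0 : ℝ) 1) :
    f1 x₀ y₀ x ∈ Icc (0 : ℝ) 1 := by
  have := f0_mem_Icc h (x := 1 - x) ⟨by linarith [hx.2], by linarith [hx.1]⟩
  exact ⟨by unfold f1; linarith [this.2], by unfold f1; linarith [this.1]⟩

theorem fb_mem_Ioo (h : A1 x₀ y₀) (b : Bool) {x : ℝ} (hx : x ∈ Ioo (0 : ℝ) 1) :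
    fb x₀ y₀ b x ∈ Ioo (0 : ℝ) 1 := by
  cases b
  · exact f0_mem_Ioo h hx
  · exact f1_mem_Ioo h hx

/-! ### Drift of the logarithmic Lyapunov function -/

theorem eventually_log_drift_pos {q₀ q₁ : ℝ → ℝ} {a b : ℝ} {s : Set ℝ}
    (h₀ : ContinuousWithinAt q₀ s 0) (h₁ : ContinuousWithinAt q₁ s 0)
    (hpos : 0 < q₀ 0 * Real.log a + q₁ 0 * Real.log b) :
    ∀ᶠ t in 𝓝[s] 0, 0 < q₀ t * (Real.log a + Real.log (1 - a * t)) +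
      q₁ t * (Real.log b + Real.log (1 - b * t)) - Real.log (1 - t) := by
  have hlog (k : ℝ) : ContinuousWithinAt (fun t => Real.log (1 - k * t)) s 0 := by
    refine ContinuousAt.continuousWithinAt (ContinuousAt.log (by fun_prop) (by simp))
  have hlog1 : ContinuousWithinAt (fun t : ℝ => Real.log (1 - t)) s 0 := by
    simpa using hlog 1
  have hc : ContinuousWithinAt (fun t => q₀ t * (Real.log a + Real.log (1 - a * t)) +
      q₁ t * (Real.log b + Real.log (1 - b * t)) - Real.log (1 - t)) s 0 :=
    ((h₀.mul (continuousWithinAt_const.add (hlog a))).add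
      (h₁.mul (continuousWithinAt_const.add (hlog b)))).sub hlog1
  exact hc.eventually (lt_mem_nhds (by simpa using hpos))

/-- Near the endpoint `0` the Lyapunov function decreases on average, for any weights
whose Lyapunov exponent at `0` is positive. -/
theorem exists_drift_near_zero (h : A1 x₀ y₀) {q₀ q₁ : ℝ → ℝ}
    (h₀ : ContinuousWithinAt q₀ (Icc 0 1) 0) (h₁ : ContinuousWithinAt q₁ (Icc 0 1) 0)
    (hsum : ∀ t ∈ Icc (0 : ℝ) 1, q₀ t + q₁ t = 1)
    (hpos : 0 < q₀ 0 * Real.log (y₀ / x₀) + q₁ 0 * Real.log ((1 - y₀) / (1 - x₀))) :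
    ∃ δ > 0, ∀ t, 0 < t → t < δ →
      U x₀ y₀ q₀ q₁ (fun y => -Real.log (y * (1 - y))) t < -Real.log (t * (1 - t)) := by
  have hev := eventually_log_drift_pos h₀ h₁ hpos
  rw [eventually_nhdsWithin_iff, Metric.eventually_nhds_iff] at hev
  obtain ⟨ε, hε, hev⟩ := hev
  obtain ⟨s1, s2, s3⟩ := h.slopes
  have hA := h
  obtain ⟨h1, h2, h3, h4⟩ := h
  refine ⟨min ε (1 - x₀), lt_min hε (by linarith), fun t ht htδ => ?_⟩
  have ht1 : t < 1 - x₀ := htδ.trans_le (min_le_right _ _)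
  have htI : t ∈ Icc (0 : ℝ) 1 := ⟨ht.le, by linarith⟩
  have htO : t ∈ Ioo (0 : ℝ) 1 := ⟨ht, by linarith⟩
  have key := hev (y := t) (by
    rw [Real.dist_eq, sub_zero, abs_of_pos ht]; exact htδ.trans_le (min_le_left _ _)) htI
  have e0 : f0 x₀ y₀ t = y₀ / x₀ * t := f0_of_le (by linarith)
  have e1 : f1 x₀ y₀ t = (1 - y₀) / (1 - x₀) * t := by
    unfold f1
    rw [f0_of_lt (by linarith)]
    ring
  have m0 := f0_mem_Ioo hA htO
  have m1 := f1_mem_Ioo hA htO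
  rw [e0] at m0
  rw [e1] at m1
  have hs := hsum t htI
  simp only [U, e0, e1]
  rw [Real.log_mul m0.1.ne' (sub_pos.2 m0.2).ne', Real.log_mul m1.1.ne' (sub_pos.2 m1.2).ne',
    Real.log_mul s1.ne' ht.ne', Real.log_mul (one_pos.trans s3).ne' ht.ne',
    Real.log_mul ht.ne' (sub_pos.2 htO.2).ne']
  have hq : q₁ t = 1 - q₀ t := by linarith
  rw [hq] at key ⊢
  nlinarith

theorem exists_drift (hA1 : A1 x₀ y₀) (hA3 : A3 p₀ p₁) (hA4 : A4 x₀ y₀ p₀ p₁) :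
    ∃ δ > 0, δ < 1 / 2 ∧ ∀ x ∈ Ioo (0 : ℝ) 1, x ∉ Icc δ (1 - δ) →
      U x₀ y₀ p₀ p₁ (fun y => -Real.log (y * (1 - y))) x < -Real.log (x * (1 - x)) := by
  obtain ⟨hc0, hc1, hp⟩ := hA3
  have z : (0 : ℝ) ∈ Icc (0 : ℝ) 1 := by simp
  have hmap : MapsTo (fun t : ℝ => 1 - t) (Icc 0 1) (Icc 0 1) :=
    fun t ht => ⟨by linarith [ht.2], by linarith [ht.1]⟩
  have hcr : ContinuousOn (fun t : ℝ => 1 - t) (Icc 0 1) := by fun_prop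
  obtain ⟨δ, hδ, hd⟩ := exists_drift_near_zero hA1 (hc0 0 z) (hc1 0 z)
    (fun t ht => (hp t ht).1) hA4.1
  obtain ⟨δ', hδ', hd'⟩ := exists_drift_near_zero hA1
    (q₀ := fun t => p₁ (1 - t)) (q₁ := fun t => p₀ (1 - t))
    ((hc1.comp hcr hmap) 0 z) ((hc0.comp hcr hmap) 0 z)
    (fun t ht => by rw [add_comm]; exact (hp _ (hmap ht)).1)
    (by simpa [add_comm] using hA4.2)
  refine ⟨min (min δ δ') (1 / 4), by positivity, (min_le_right _ _).trans_lt (by norm_num),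
    fun x hx hxK => ?_⟩
  have l1 : min (min δ δ') (1 / 4) ≤ δ := (min_le_left _ _).trans (min_le_left _ _)
  have l2 : min (min δ δ') (1 / 4) ≤ δ' := (min_le_left _ _).trans (min_le_right _ _)
  rcases lt_or_ge x (min (min δ δ') (1 / 4)) with hlt | hge
  · exact hd x hx.1 (by linarith)
  · have hgt : 1 - min (min δ δ') (1 / 4) < x := by
      by_contra hcon
      exact hxK ⟨hge, not_lt.1 hcon⟩
    have := hd' (1 - x) (by linarith [hx.2]) (by linarith)
    simp only [U, f1, sub_sub_cancel] at this ⊢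
    rw [mul_comm x, mul_comm (f0 x₀ y₀ x), mul_comm (1 - f0 x₀ y₀ (1 - x)), add_comm]
    exact this

/-! ### Maximum principle -/

/-- A bounded upper semicontinuous subharmonic function attains its maximum inside `(0,1)`. -/
theorem exists_max_of_subharmonic (hA1 : A1 x₀ y₀) (hA3 : A3 p₀ p₁) (hA4 : A4 x₀ y₀ p₀ p₁)
    {u : ℝ → ℝ} (husc : UpperSemicontinuousOn u (Icc 0 1))
    (hu0 : ∀ x ∈ Ioo (0 : ℝ) 1, 0 ≤ u x) (hu1 : ∀ x ∈ Ioo (0 : ℝ) 1, u x ≤ 1)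
    (hsub : ∀ x ∈ Ioo (0 : ℝ) 1, u x ≤ U x₀ y₀ p₀ p₁ u x) :
    ∃ m ∈ Ioo (0 : ℝ) 1, ∀ x ∈ Ioo (0 : ℝ) 1, u x ≤ u m := by
  obtain ⟨δ, hδ, hδ2, hdrift⟩ := exists_drift hA1 hA3 hA4
  set V : ℝ → ℝ := fun y => -Real.log (y * (1 - y)) with hV
  have hVpos : ∀ y ∈ Ioo (0 : ℝ) 1, 0 ≤ V y := fun y hy => by
    have := Real.log_nonpos (x := y * (1 - y)) (by nlinarith [hy.1, hy.2])
      (by nlinarith [hy.1, hy.2])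
    simp only [hV]; linarith
  obtain ⟨m, hmK, hmax⟩ := UpperSemicontinuousOn.exists_isMaxOn
    (nonempty_Icc.2 (by linarith : δ ≤ 1 - δ)) isCompact_Icc
    (husc.mono (Icc_subset_Icc hδ.le (by linarith)))
  have hm : m ∈ Ioo (0 : ℝ) 1 := ⟨by linarith [hmK.1], by linarith [hmK.2]⟩
  refine ⟨m, hm, fun x hx => ?_⟩
  by_contra! hlt
  have hVx := hVpos x hx
  obtain ⟨η, hη, hηx⟩ : ∃ η > 0, u m < u x - η * V x := by
    refine ⟨(u x - u m) / (V x + 1) / 2, by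
      have : 0 < u x - u m := by linarith
      positivity, ?_⟩
    have e : (u x - u m) / (V x + 1) * (V x + 1) = u x - u m := div_mul_cancel₀ _ (by linarith)
    have : 0 < (u x - u m) / (V x + 1) := div_pos (by linarith) (by linarith)
    nlinarith
  set S : Set ℝ := Icc 0 1 ∩ {y | Real.exp (-(1 / η)) ≤ y * (1 - y)} with hS
  have hScomp : IsCompact S :=
    isCompact_Icc.inter_right (isClosed_le (by fun_prop) (by fun_prop))
  have hSprod : ∀ y ∈ S, 0 < y * (1 - y) := fun y hy => (Real.exp_pos _).trans_le hy.2
  have hSIoo : S ⊆ Ioo 0 1 := fun y hy => by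
    have := hSprod y hy
    have h1 := hy.1.1
    have h2 := hy.1.2
    constructor <;> by_contra! <;> nlinarith
  have hout : ∀ y ∈ Ioo (0 : ℝ) 1, y ∉ S → u y - η * V y < 0 := fun y hy hyS => by
    have hlt' : y * (1 - y) < Real.exp (-(1 / η)) := by
      by_contra! hcon
      exact hyS ⟨Ioo_subset_Icc_self hy, hcon⟩
    have := (Real.log_lt_iff_lt_exp (mul_pos hy.1 (by linarith [hy.2]))).2 hlt'
    have hVy : 1 / η < V y := by simp only [hV]; linarith
    rw [div_lt_iff₀' hη] at hVy
    linarith [hu1 y hy]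
  have hxS : x ∈ S := by
    by_contra hcon
    linarith [hout x hx hcon, hu0 m hm]
  have hVcont : ContinuousOn V S :=
    (ContinuousOn.log (by fun_prop) fun y hy => (hSprod y hy).ne').neg
  have hwusc : UpperSemicontinuousOn (fun y => u y + -(η * V y)) S :=
    (husc.mono inter_subset_left).add
      (continuousOn_const.mul hVcont).neg.upperSemicontinuousOn
  obtain ⟨z, hzS, hzmax⟩ := UpperSemicontinuousOn.exists_isMaxOn ⟨x, hxS⟩ hScomp hwusc
  have hz := hSIoo hzS
  have hzx : u x + -(η * V x) ≤ u z + -(η * V z) := hzmax hxS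
  have hall : ∀ y ∈ Ioo (0 : ℝ) 1, u y - η * V y ≤ u z - η * V z := fun y hy => by
    by_cases hyS : y ∈ S
    · have : u y + -(η * V y) ≤ u z + -(η * V z) := hzmax hyS
      linarith
    · linarith [hout y hy hyS, hu0 m hm]
  have hzK : z ∉ Icc δ (1 - δ) := fun hzK => by
    have h1 : u z ≤ u m := hmax hzK
    have := mul_nonneg hη.le (hVpos z hz)
    linarith
  have hd := hdrift z hz hzK
  obtain ⟨hs, hp0, -, hp1, -⟩ := hA3.2.2 z (Ioo_subset_Icc_self hz)
  have g0 := mul_le_mul_of_nonneg_left (hall _ (f0_mem_Ioo hA1 hz)) hp0.le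
  have g1 := mul_le_mul_of_nonneg_left (hall _ (f1_mem_Ioo hA1 hz)) hp1.le
  have hsz := hsub z hz
  simp only [U] at hd hsz
  have hd' := mul_lt_mul_of_pos_left hd hη
  have e : (p₀ z + p₁ z) * (u z - η * V z) = u z - η * V z := by rw [hs, one_mul]
  have e2 : η * V z = η * -Real.log (z * (1 - z)) := rfl
  linarith

/-! ### Accessibility of the fixed point -/

/-- A nonempty subset of `(0,1)` invariant under `f₀` and `f₁` meets every neighbourhood of `c`. -/
theorem exists_mem_near_of_invariant (hA1 : A1 x₀ y₀) {c ρ : ℝ} (hρ : 0 < ρ)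
    (hc : c ∈ Ioo (1 - x₀) y₀) (hfix : f0 x₀ y₀ (f1 x₀ y₀ c) = c)
    {M : Set ℝ} (hMI : M ⊆ Ioo 0 1) (hne : M.Nonempty)
    (h₀ : MapsTo (f0 x₀ y₀) M M) (h₁ : MapsTo (f1 x₀ y₀) M M) :
    ∃ y ∈ M, |y - c| < ρ := by
  obtain ⟨s1, s2, s3⟩ := hA1.slopes
  obtain ⟨k1, k2, k3, k4⟩ := hA1
  have e0 : y₀ / x₀ * x₀ = y₀ := div_mul_cancel₀ _ (by linarith)
  have e1 : (1 - y₀) / (1 - x₀) * (1 - x₀) = 1 - y₀ := div_mul_cancel₀ _ (by linarith)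
  have e2 : 1 - x₀ ≤ y₀ / x₀ * (1 - y₀) := by
    rw [div_mul_eq_mul_div, le_div_iff₀ (by linarith)]
    nlinarith
  set a := y₀ / x₀ with ha
  set b := (1 - y₀) / (1 - x₀) with hb
  have middle : ∀ y ∈ M, y₀ ≤ y → y ≤ x₀ → ∃ z ∈ M, z ∈ Icc (1 - x₀) y₀ := by
    intro y hy h1 h2
    refine ⟨_, h₀ hy, ?_⟩
    rw [f0_of_le h2, ← ha]
    constructor <;> nlinarith
  have right : ∀ n : ℕ, ∀ y ∈ M, y₀ ≤ y → 1 - x₀ ≤ b ^ n * (1 - y) →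
      ∃ z ∈ M, z ∈ Icc (1 - x₀) y₀ := by
    intro n
    induction n with
    | zero => intro y hy h1 h2; exact middle y hy h1 (by linarith)
    | succ n ih =>
      intro y hy h1 h2
      rcases le_or_gt y x₀ with hle | hlt
      · exact middle y hy h1 hle
      · refine ih _ (h₀ hy) ?_ ?_
        · rw [f0_of_lt hlt, ← hb]; nlinarith
        · rw [f0_of_lt hlt, ← hb]
          refine h2.trans (le_of_eq ?_)
          ring
  have left : ∀ n : ℕ, ∀ y ∈ M, y ≤ y₀ → 1 - x₀ ≤ b ^ n * y →
      ∃ z ∈ M, z ∈ Icc (1 - x₀) y₀ := by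
    intro n
    induction n with
    | zero => intro y hy h1 h2; exact ⟨y, hy, by linarith, h1⟩
    | succ n ih =>
      intro y hy h1 h2
      rcases le_or_gt (1 - x₀) y with hle | hlt
      · exact ⟨y, hy, hle, h1⟩
      · have e : f1 x₀ y₀ y = b * y := by
          unfold f1; rw [f0_of_lt (by linarith), ← hb]; ring
        refine ih _ (h₁ hy) ?_ ?_
        · rw [e]; nlinarith
        · rw [e]
          refine h2.trans (le_of_eq ?_)
          ring
  have comp : ∀ y ∈ Icc (1 - x₀) y₀,
      f0 x₀ y₀ (f1 x₀ y₀ y) = a * (1 - a * (1 - y)) := by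
    intro y hy
    have e : f1 x₀ y₀ y = 1 - a * (1 - y) := by
      unfold f1; rw [f0_of_le (by linarith [hy.1])]
    rw [e, f0_of_le (by nlinarith [hy.2])]
  have near : ∀ n : ℕ, ∀ y ∈ M, y ∈ Icc (1 - x₀) y₀ → (a ^ 2) ^ n * |y - c| < ρ →
      ∃ z ∈ M, |z - c| < ρ := by
    intro n
    induction n with
    | zero => intro y hy _ h2; exact ⟨y, hy, by simpa using h2⟩
    | succ n ih =>
      intro y hy hyJ h2
      refine ih _ (h₀ (h₁ hy)) ?_ ?_
      · rw [comp y hyJ]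
        have l1 : a * (1 - x₀) ≤ a * y := mul_le_mul_of_nonneg_left hyJ.1 s1.le
        have t1 : 1 - y₀ ≤ 1 - a * (1 - y) := by nlinarith
        have t2 : 1 - a * (1 - y) ≤ x₀ := by nlinarith [hyJ.2]
        constructor <;> nlinarith
      · have ec : f0 x₀ y₀ (f1 x₀ y₀ y) - c = a ^ 2 * (y - c) := by
          have := comp c (Ioo_subset_Icc_self hc)
          rw [hfix] at this
          rw [comp y hyJ]
          linear_combination -this
        rw [ec, abs_mul, abs_of_nonneg (sq_nonneg a), ← mul_assoc, ← pow_succ]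
        exact h2
  obtain ⟨z, hzM, hzJ⟩ : ∃ z ∈ M, z ∈ Icc (1 - x₀) y₀ := by
    obtain ⟨y, hy⟩ := hne
    have large : ∀ t : ℝ, 0 < t → ∃ n : ℕ, 1 - x₀ ≤ b ^ n * t := fun t ht => by
      obtain ⟨n, hn⟩ := pow_unbounded_of_one_lt ((1 - x₀) / t) s3
      rw [div_lt_iff₀ ht] at hn
      exact ⟨n, hn.le⟩
    rcases le_total y y₀ with hle | hge
    · obtain ⟨n, hn⟩ := large y (hMI hy).1
      exact left n y hy hle hn
    · obtain ⟨n, hn⟩ := large (1 - y) (by linarith [(hMI hy).2])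
      exact right n y hy hge hn
  have hlim : Tendsto (fun n : ℕ => (a ^ 2) ^ n * |z - c|) atTop (𝓝 0) := by
    simpa using (tendsto_pow_atTop_nhds_zero_of_lt_one (sq_nonneg a)
      (by nlinarith : a ^ 2 < 1)).mul_const |z - c|
  obtain ⟨n, hn⟩ := (hlim.eventually (gt_mem_nhds hρ)).exists
  exact near n z hzM hzJ hn

/-! ### The avoidance functions -/

/-- The expectation of `ψ (X₁) ⋯ ψ (X_n)` for the random orbit `(X_k)` started at `x`. -/
noncomputable def avoid (x₀ y₀ : ℝ) (p₀ p₁ ψ : ℝ → ℝ) : ℕ → ℝ → ℝ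
  | 0 => fun _ => 1
  | n + 1 => U x₀ y₀ p₀ p₁ fun y => ψ y * avoid x₀ y₀ p₀ p₁ ψ n y

section avoid

variable {ψ : ℝ → ℝ}

theorem avoid_mem_Icc (hA1 : A1 x₀ y₀) (hA3 : A3 p₀ p₁)
    (hψ : ∀ y, ψ y ∈ Icc (0 : ℝ) 1) (n : ℕ) :
    ∀ x ∈ Icc (0 : ℝ) 1, avoid x₀ y₀ p₀ p₁ ψ n x ∈ Icc (0 : ℝ) 1 := by
  induction n with
  | zero => intro x _; simp [avoid]
  | succ n ih =>
    intro x hx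
    obtain ⟨hs, hp0, -, hp1, -⟩ := hA3.2.2 x hx
    have g (y : ℝ) (hy : y ∈ Icc (0 : ℝ) 1) :
        ψ y * avoid x₀ y₀ p₀ p₁ ψ n y ∈ Icc (0 : ℝ) 1 :=
      unitInterval.mul_mem (hψ y) (ih y hy)
    have g0 := g _ (f0_mem_Icc hA1 hx)
    have g1 := g _ (f1_mem_Icc hA1 hx)
    simp only [avoid, U]
    constructor
    · have := mul_nonneg hp0.le g0.1
      have := mul_nonneg hp1.le g1.1
      linarith
    · have := mul_le_mul_of_nonneg_left g0.2 hp0.le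
      have := mul_le_mul_of_nonneg_left g1.2 hp1.le
      linarith

theorem avoid_succ_le (hA1 : A1 x₀ y₀) (hA3 : A3 p₀ p₁)
    (hψ : ∀ y, ψ y ∈ Icc (0 : ℝ) 1) (n : ℕ) :
    ∀ x ∈ Icc (0 : ℝ) 1, avoid x₀ y₀ p₀ p₁ ψ (n + 1) x ≤ avoid x₀ y₀ p₀ p₁ ψ n x := by
  induction n with
  | zero => intro x hx; exact (avoid_mem_Icc hA1 hA3 hψ 1 x hx).2
  | succ n ih =>
    intro x hx
    obtain ⟨-, hp0, -, hp1, -⟩ := hA3.2.2 x hx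
    rw [avoid, avoid]
    exact add_le_add
      (mul_le_mul_of_nonneg_left (mul_le_mul_of_nonneg_left (ih _ (f0_mem_Icc hA1 hx))
        (hψ _).1) hp0.le)
      (mul_le_mul_of_nonneg_left (mul_le_mul_of_nonneg_left (ih _ (f1_mem_Icc hA1 hx))
        (hψ _).1) hp1.le)

theorem continuousOn_avoid (hA1 : A1 x₀ y₀) (hA3 : A3 p₀ p₁) (hψ : Continuous ψ) (n : ℕ) :
    ContinuousOn (avoid x₀ y₀ p₀ p₁ ψ n) (Icc 0 1) := by
  induction n with
  | zero => exact continuousOn_const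
  | succ n ih =>
    have g := hψ.continuousOn.mul ih
    exact (hA3.1.mul (g.comp (continuous_f0 hA1).continuousOn fun _ => f0_mem_Icc hA1)).add
      (hA3.2.1.mul (g.comp (continuous_f1 hA1).continuousOn fun _ => f1_mem_Icc hA1))

theorem tendsto_avoid (hA1 : A1 x₀ y₀) (hA3 : A3 p₀ p₁) (hψ : ∀ y, ψ y ∈ Icc (0 : ℝ) 1)
    {x : ℝ} (hx : x ∈ Icc (0 : ℝ) 1) :
    Tendsto (fun n => avoid x₀ y₀ p₀ p₁ ψ n x) atTop
      (𝓝 (⨅ n, avoid x₀ y₀ p₀ p₁ ψ n x)) :=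
  tendsto_atTop_ciInf (antitone_nat_of_succ_le fun n => avoid_succ_le hA1 hA3 hψ n x hx)
    ⟨0, by rintro _ ⟨n, rfl⟩; exact (avoid_mem_Icc hA1 hA3 hψ n x hx).1⟩

theorem iInf_avoid_eq (hA1 : A1 x₀ y₀) (hA3 : A3 p₀ p₁) (hψ : ∀ y, ψ y ∈ Icc (0 : ℝ) 1)
    {x : ℝ} (hx : x ∈ Icc (0 : ℝ) 1) :
    ⨅ n, avoid x₀ y₀ p₀ p₁ ψ n x =
      U x₀ y₀ p₀ p₁ (fun y => ψ y * ⨅ n, avoid x₀ y₀ p₀ p₁ ψ n y) x := by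
  refine tendsto_nhds_unique ((tendsto_add_atTop_iff_nat 1).2 (tendsto_avoid hA1 hA3 hψ hx)) ?_
  exact (((tendsto_avoid hA1 hA3 hψ (f0_mem_Icc hA1 hx)).const_mul _).const_mul _).add
    (((tendsto_avoid hA1 hA3 hψ (f1_mem_Icc hA1 hx)).const_mul _).const_mul _)

theorem iInf_avoid_eq_zero (hA1 : A1 x₀ y₀) (hA3 : A3 p₀ p₁) (hA4 : A4 x₀ y₀ p₀ p₁)
    (hψ : ∀ y, ψ y ∈ Icc (0 : ℝ) 1) (hψc : Continuous ψ) {c ρ : ℝ} (hρ : 0 < ρ)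
    (hψlt : ∀ y, |y - c| < ρ → ψ y < 1)
    (hc : c ∈ Ioo (1 - x₀) y₀) (hfix : f0 x₀ y₀ (f1 x₀ y₀ c) = c)
    {x : ℝ} (hx : x ∈ Ioo (0 : ℝ) 1) :
    ⨅ n, avoid x₀ y₀ p₀ p₁ ψ n x = 0 := by
  set u : ℝ → ℝ := fun x => ⨅ n, avoid x₀ y₀ p₀ p₁ ψ n x with hu
  have hbdd : ∀ x ∈ Icc (0 : ℝ) 1, BddBelow (range fun n => avoid x₀ y₀ p₀ p₁ ψ n x) :=
    fun x hx => ⟨0, by rintro _ ⟨n, rfl⟩; exact (avoid_mem_Icc hA1 hA3 hψ n x hx).1⟩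
  have hu0 : ∀ x ∈ Ioo (0 : ℝ) 1, 0 ≤ u x := fun x hx =>
    le_ciInf fun n => (avoid_mem_Icc hA1 hA3 hψ n x (Ioo_subset_Icc_self hx)).1
  have hu1 : ∀ x ∈ Ioo (0 : ℝ) 1, u x ≤ 1 := fun x hx =>
    ciInf_le (hbdd x (Ioo_subset_Icc_self hx)) 0
  have hle : ∀ y ∈ Ioo (0 : ℝ) 1, ψ y * u y ≤ u y := fun y hy =>
    mul_le_of_le_one_left (hu0 y hy) (hψ y).2
  have hfixed : ∀ x ∈ Ioo (0 : ℝ) 1,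
      u x = p₀ x * (ψ (f0 x₀ y₀ x) * u (f0 x₀ y₀ x)) +
        p₁ x * (ψ (f1 x₀ y₀ x) * u (f1 x₀ y₀ x)) := fun x hx =>
    iInf_avoid_eq hA1 hA3 hψ (Ioo_subset_Icc_self hx)
  have husc : UpperSemicontinuousOn u (Icc 0 1) :=
    upperSemicontinuousOn_ciInf hbdd fun n =>
      (continuousOn_avoid hA1 hA3 hψc n).upperSemicontinuousOn
  obtain ⟨m, hm, hmax⟩ := exists_max_of_subharmonic hA1 hA3 hA4 husc hu0 hu1 fun x hx => by
    obtain ⟨-, hp0, -, hp1, -⟩ := hA3.2.2 x (Ioo_subset_Icc_self hx)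
    rw [hfixed x hx]
    exact add_le_add (mul_le_mul_of_nonneg_left (hle _ (f0_mem_Ioo hA1 hx)) hp0.le)
      (mul_le_mul_of_nonneg_left (hle _ (f1_mem_Ioo hA1 hx)) hp1.le)
  refine le_antisymm ((hmax x hx).trans ?_) (hu0 x hx)
  by_contra! hpos
  set M : Set ℝ := {y | y ∈ Ioo (0 : ℝ) 1 ∧ u y = u m} with hM
  have hprod : ∀ y ∈ M, ψ (f0 x₀ y₀ y) * u (f0 x₀ y₀ y) = u m ∧
      ψ (f1 x₀ y₀ y) * u (f1 x₀ y₀ y) = u m := by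
    rintro y ⟨hy, hym⟩
    obtain ⟨hs, hp0, -, hp1, -⟩ := hA3.2.2 y (Ioo_subset_Icc_self hy)
    have i0 := f0_mem_Ioo hA1 hy
    have i1 := f1_mem_Ioo hA1 hy
    have g0 := (hle _ i0).trans (hmax _ i0)
    have g1 := (hle _ i1).trans (hmax _ i1)
    have hf := hfixed y hy
    rw [hym] at hf
    have e : (p₀ y + p₁ y) * u m = u m := by rw [hs, one_mul]
    constructor
    · refine le_antisymm g0 ?_
      by_contra! hcon
      linarith [mul_lt_mul_of_pos_left hcon hp0, mul_le_mul_of_nonneg_left g1 hp1.le]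
    · refine le_antisymm g1 ?_
      by_contra! hcon
      linarith [mul_lt_mul_of_pos_left hcon hp1, mul_le_mul_of_nonneg_left g0 hp0.le]
  have step : ∀ y ∈ Ioo (0 : ℝ) 1, ψ y * u y = u m → y ∈ M ∧ ψ y = 1 := fun y hy h => by
    have h1 : u y = u m := le_antisymm (hmax y hy) (h ▸ hle y hy)
    refine ⟨⟨hy, h1⟩, ?_⟩
    rw [h1] at h
    exact mul_right_cancel₀ hpos.ne' (by rw [h, one_mul])
  have map0 : ∀ y ∈ M, f0 x₀ y₀ y ∈ M ∧ ψ (f0 x₀ y₀ y) = 1 := fun y hy =>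
    step _ (f0_mem_Ioo hA1 hy.1) (hprod y hy).1
  have map1 : ∀ y ∈ M, f1 x₀ y₀ y ∈ M ∧ ψ (f1 x₀ y₀ y) = 1 := fun y hy =>
    step _ (f1_mem_Ioo hA1 hy.1) (hprod y hy).2
  obtain ⟨y, hy, hyc⟩ := exists_mem_near_of_invariant hA1 hρ hc hfix
    (M := {y | y ∈ M ∧ ψ y = 1}) (fun y hy => hy.1.1) ⟨_, map0 m ⟨hm, rfl⟩⟩
    (fun y hy => map0 y hy.1) (fun y hy => map1 y hy.1)
  exact (hψlt y hyc).ne hy.2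

end avoid

/-! ### Cylinder estimates -/

theorem cyl_nil : cyl [] = univ := by
  ext ω
  simp [cyl]

theorem mem_cyl_append_singleton {ω : ℕ → Bool} {v : List Bool} {b : Bool} :
    ω ∈ cyl (v ++ [b]) ↔ ω ∈ cyl v ∧ ω v.length = b := by
  simp only [cyl, mem_ofPred_eq, Fin.forall_iff, List.get_eq_getElem, List.length_append,
    List.length_singleton]
  constructor
  · intro h
    refine ⟨fun j hj => ?_, ?_⟩
    · rw [h j (by omega), List.getElem_append_left hj]
    · rw [h v.length (by omega)]
      simp
  · rintro ⟨h, hb⟩ j hj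
    rcases Nat.lt_succ_iff_lt_or_eq.1 hj with hj' | rfl
    · rw [h j hj', List.getElem_append_left hj']
    · simpa using hb

theorem cylProb_append_singleton (x : ℝ) (v : List Bool) (b : Bool) :
    cylProb x₀ y₀ p₀ p₁ x (v ++ [b]) = cylProb x₀ y₀ p₀ p₁ x v *
      (if b then p₁ (v.foldl (fun y i => fb x₀ y₀ i y) x)
        else p₀ (v.foldl (fun y i => fb x₀ y₀ i y) x)) := by
  induction v generalizing x with
  | nil => simp [cylProb]
  | cons a v ih => simp only [List.cons_append, cylProb, ih, List.foldl_cons, mul_assoc]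

theorem foldl_mem_Ioo (hA1 : A1 x₀ y₀) {x : ℝ} (hx : x ∈ Ioo (0 : ℝ) 1) (v : List Bool) :
    v.foldl (fun y i => fb x₀ y₀ i y) x ∈ Ioo (0 : ℝ) 1 := by
  induction v generalizing x with
  | nil => exact hx
  | cons a v ih => exact ih (fb_mem_Ioo hA1 a hx)

theorem cylProb_nonneg (hA1 : A1 x₀ y₀) (hA3 : A3 p₀ p₁) {x : ℝ} (hx : x ∈ Ioo (0 : ℝ) 1)
    (v : List Bool) : 0 ≤ cylProb x₀ y₀ p₀ p₁ x v := by
  induction v generalizing x with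
  | nil => exact zero_le_one
  | cons a v ih =>
    obtain ⟨-, hp0, -, hp1, -⟩ := hA3.2.2 x (Ioo_subset_Icc_self hx)
    refine mul_nonneg ?_ (ih (fb_mem_Ioo hA1 a hx))
    split_ifs
    exacts [hp1.le, hp0.le]

theorem iter_of_mem_cyl {ω : ℕ → Bool} (x : ℝ) {v : List Bool} (h : ω ∈ cyl v) :
    iter x₀ y₀ ω v.length x = v.foldl (fun y i => fb x₀ y₀ i y) x := by
  induction v using List.reverseRecOn with
  | nil => rfl
  | append_singleton v b ih =>
    obtain ⟨hv, hb⟩ := mem_cyl_append_singleton.1 h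
    simp [iter, ih hv, hb]

/-- Probability of starting with the word `v` and never visiting `H`. -/
theorem measure_cyl_inter_le (hA1 : A1 x₀ y₀) (hA3 : A3 p₀ p₁)
    {Pm : ℝ → Measure (ℕ → Bool)} (hPm : IsKernel x₀ y₀ p₀ p₁ Pm)
    {ψ : ℝ → ℝ} (hψ : ∀ y, ψ y ∈ Icc (0 : ℝ) 1) {H : Set ℝ} (hψH : ∀ y ∉ H, ψ y = 1)
    {x : ℝ} (hx : x ∈ Ioo (0 : ℝ) 1) (n : ℕ) (v : List Bool) :
    Pm x (cyl v ∩ {ω | ∀ k, 1 ≤ k → iter x₀ y₀ ω k x ∉ H}) ≤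
      ENNReal.ofReal (cylProb x₀ y₀ p₀ p₁ x v *
        avoid x₀ y₀ p₀ p₁ ψ n (v.foldl (fun y i => fb x₀ y₀ i y) x)) := by
  set A : Set (ℕ → Bool) := {ω | ∀ k, 1 ≤ k → iter x₀ y₀ ω k x ∉ H} with hA
  induction n generalizing v with
  | zero =>
    simp only [avoid, mul_one]
    exact (measure_mono inter_subset_left).trans (hPm x hx v).le
  | succ n ih =>
    set z := v.foldl (fun y i => fb x₀ y₀ i y) x with hz
    have hzI : z ∈ Ioo (0 : ℝ) 1 := foldl_mem_Ioo hA1 hx v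
    obtain ⟨-, hp0, -, hp1, -⟩ := hA3.2.2 z (Ioo_subset_Icc_self hzI)
    have hcv := cylProb_nonneg hA1 hA3 hx v
    have hav : ∀ b, 0 ≤ ψ (fb x₀ y₀ b z) * avoid x₀ y₀ p₀ p₁ ψ n (fb x₀ y₀ b z) := fun b =>
      mul_nonneg (hψ _).1
        (avoid_mem_Icc hA1 hA3 hψ n _ (Ioo_subset_Icc_self (fb_mem_Ioo hA1 b hzI))).1
    have branch : ∀ b : Bool, Pm x (cyl (v ++ [b]) ∩ A) ≤
        ENNReal.ofReal (cylProb x₀ y₀ p₀ p₁ x v * ((if b then p₁ z else p₀ z) *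
          (ψ (fb x₀ y₀ b z) * avoid x₀ y₀ p₀ p₁ ψ n (fb x₀ y₀ b z)))) := by
      intro b
      by_cases hb : fb x₀ y₀ b z ∈ H
      · have : cyl (v ++ [b]) ∩ A = ∅ := by
          rw [eq_empty_iff_forall_notMem]
          rintro ω ⟨hω, hωA⟩
          refine hωA (v ++ [b]).length (by simp) ?_
          rw [iter_of_mem_cyl x hω]
          simpa [← hz] using hb
        rw [this, measure_empty]
        exact zero_le
      · have := ih (v ++ [b])
        rw [cylProb_append_singleton, List.foldl_append] at this
        simpa [← hz, hψH _ hb, mul_assoc] using this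
    have hsub : cyl v ∩ A ⊆ (cyl (v ++ [false]) ∩ A) ∪ (cyl (v ++ [true]) ∩ A) := by
      rintro ω ⟨hω, hωA⟩
      cases h : ω v.length
      · exact Or.inl ⟨mem_cyl_append_singleton.2 ⟨hω, h⟩, hωA⟩
      · exact Or.inr ⟨mem_cyl_append_singleton.2 ⟨hω, h⟩, hωA⟩
    refine (measure_mono hsub).trans ((measure_union_le _ _).trans
      ((add_le_add (branch false) (branch true)).trans ?_))
    rw [← ENNReal.ofReal_add
      (mul_nonneg hcv (mul_nonneg (by simpa using hp0.le) (hav false)))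
      (mul_nonneg hcv (mul_nonneg (by simpa using hp1.le) (hav true))), ← mul_add]
    exact le_of_eq rfl

end AM

/-- Lemma 7: with `c` the unique fixed point of `f₀ ∘ f₁` in `[1−x₀, y₀]`, for
every `ρ > 0` and `x ∈ (0,1)`, the random orbit from `x` hits `(c−ρ, c+ρ)` in finite time
`ℙ_x`-almost surely. -/
theorem stmt15 (x₀ y₀ : ℝ) (p₀ p₁ : ℝ → ℝ)
    (hA1 : AM.A1 x₀ y₀) (hA2 : AM.A2 p₀ p₁) (hA3 : AM.A3 p₀ p₁) (hA4 : AM.A4 x₀ y₀ p₀ p₁)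
    (Pm : ℝ → MeasureTheory.Measure (ℕ → Bool)) (hPm : AM.IsKernel x₀ y₀ p₀ p₁ Pm)
    (c : ℝ) (hc : c ∈ Set.Ioo (1 - x₀) y₀) (hfix : AM.f0 x₀ y₀ (AM.f1 x₀ y₀ c) = c)
    (huniq : ∀ c' ∈ Set.Icc (1 - x₀) y₀, AM.f0 x₀ y₀ (AM.f1 x₀ y₀ c') = c' → c' = c) :
    ∀ ρ : ℝ, 0 < ρ → ∀ x ∈ Set.Ioo (0:ℝ) 1,
      Pm x {ω : ℕ → Bool | ∃ n : ℕ, 1 ≤ n ∧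
        AM.iter x₀ y₀ ω n x ∈ Set.Ioo (c - ρ) (c + ρ)} = 1 := by
  intro ρ hρ x hx
  set ψ : ℝ → ℝ := fun y => min 1 (|y - c| / ρ) with hψ
  have hψI : ∀ y, ψ y ∈ Icc (0 : ℝ) 1 := fun y => ⟨by positivity, min_le_left _ _⟩
  have hψH : ∀ y ∉ Ioo (c - ρ) (c + ρ), ψ y = 1 := fun y hy => by
    refine min_eq_left ((one_le_div hρ).2 ?_)
    by_contra! h
    rw [abs_lt] at h
    exact hy ⟨by linarith, by linarith⟩
  have hψlt : ∀ y, |y - c| < ρ → ψ y < 1 := fun y hy =>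
    (min_le_right _ _).trans_lt ((div_lt_one hρ).2 hy)
  have hψc : Continuous ψ := by fun_prop
  have huniv : Pm x univ = 1 := by
    rw [← AM.cyl_nil, hPm x hx []]
    simp [AM.cylProb]
  have hlim := AM.tendsto_avoid (p₀ := p₀) (p₁ := p₁) hA1 hA3 hψI (Ioo_subset_Icc_self hx)
  rw [AM.iInf_avoid_eq_zero hA1 hA3 hA4 hψI hψc hρ hψlt hc hfix hx] at hlim
  have hnull : Pm x {ω | ∀ k, 1 ≤ k → AM.iter x₀ y₀ ω k x ∉ Ioo (c - ρ) (c + ρ)} = 0 := by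
    refine le_antisymm (ge_of_tendsto' (x := atTop)
      (by simpa using ENNReal.tendsto_ofReal hlim) fun n => ?_) zero_le
    simpa [AM.cyl_nil, AM.cylProb] using
      AM.measure_cyl_inter_le hA1 hA3 hPm hψI hψH hx n []
  refine le_antisymm (huniv ▸ measure_mono (subset_univ _)) ?_
  rw [← huniv, ← add_zero (Pm x {ω | _}), ← hnull]
  refine (measure_mono fun ω _ => ?_).trans (measure_union_le _ _)
  by_cases h : ∃ n : ℕ, 1 ≤ n ∧ AM.iter x₀ y₀ ω n x ∈ Ioo (c - ρ) (c + ρ)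
  · exact Or.inl h
  · exact Or.inr fun k hk hmem => h ⟨k, hk, hmem⟩
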